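/- arXiv:2003.04724 — 11 statements merged into one kernel-verified Lean document; each statement's English description precedes it below -/
import Mathlib

section
/- Assume hypothesis (D). Then for every k ∈ {0, …, K+1} one has E_k = ⋃_{l=k}^{K} ⋃_{j ∈ J_l} E^j_k, and moreover the sets E^j_k appearing in this union (over all j ∈ J with lvl(j) ≥ k) are pairwise disjoint. -/
open Metric Set MeasureTheory

/-- Under the separation hypothesis (D), for every `k ∈ {0, …, K+1}` the set
`E_k` decomposes as `⋃_{l=k}^{K} ⋃_{j ∈ J_l} E^j_k`, and the sets `E^j_k` (over all `j` with
`lvl j ≥ k`) are pairwise disjoint. -/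
theorem stmt_0
    (d : ℕ) (hd : 1 ≤ d)
    (θ : ℝ) (hθ : 1 < θ)
    (K : ℕ)
    (J : Type) [Fintype J]
    (lvl : J → ℕ) (hlvl : ∀ j, lvl j ≤ K)
    (z : J → EuclideanSpace ℝ (Fin d)) (r : J → ℝ) (hr : ∀ j, 0 < r j)
    (E : ℕ → Set (EuclideanSpace ℝ (Fin d)))
    (hEtop : E (K + 1) = ∅)
    (hErec : ∀ k ≤ K, E k =
      (E (k + 1) \ ⋃ j, ⋃ (_ : lvl j = k),
          (ball (z j) (θ * r j) \ ball (z j) (r j)))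
        ∪ ⋃ j, ⋃ (_ : lvl j = k), ball (z j) (r j))
    (hD : ∀ i j : J, i ≠ j → |(lvl i : ℤ) - (lvl j : ℤ)| ≤ 1 →
      Disjoint (ball (z i) (θ ^ 2 * r i)) (ball (z j) (θ ^ 2 * r j))) :
    ∀ k ≤ K + 1,
      (E k = ⋃ j, ⋃ (_ : k ≤ lvl j),
          (ball (z j) (r j) \ ⋃ i, ⋃ (_ : k ≤ lvl i ∧ lvl i < lvl j),
            ball (z i) (θ * r i)))
      ∧ (∀ j j' : J, k ≤ lvl j → k ≤ lvl j' → j ≠ j' →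
          Disjoint
            (ball (z j) (r j) \ ⋃ i, ⋃ (_ : k ≤ lvl i ∧ lvl i < lvl j),
              ball (z i) (θ * r i))
            (ball (z j') (r j') \ ⋃ i, ⋃ (_ : k ≤ lvl i ∧ lvl i < lvl j'),
              ball (z i) (θ * r i))) := by
  have hsub : ∀ j, ball (z j) (r j) ⊆ ball (z j) (θ * r j) := fun j =>
    ball_subset_ball (le_mul_of_one_le_left (hr j).le hθ.le)
  have hsub_sq : ∀ j, ball (z j) (r j) ⊆ ball (z j) (θ ^ 2 * r j) := fun j =>
    ball_subset_ball (le_mul_of_one_le_left (hr j).le (one_le_pow₀ hθ.le))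
  intro k hk
  constructor
  · induction hk using Nat.decreasingInduction with
    | self =>
      rw [hEtop]
      symm
      simp only [iUnion_eq_empty]
      intro j hj
      have := hlvl j
      omega
    | of_succ k hk ih =>
      rw [hErec k (by omega), ih]
      ext x
      simp only [mem_union, mem_sdiff, mem_iUnion, exists_prop, not_exists, not_and]
      constructor
      · rintro (⟨⟨j, hj, hxj, hxi⟩, hann⟩ | ⟨j, hj, hxj⟩)
        · by_cases hx : ∃ i, lvl i = k ∧ x ∈ ball (z i) (θ * r i)
          · obtain ⟨i, hi, hxθ⟩ := hx
            exact ⟨i, hi.ge, not_not.mp (hann i hi hxθ), fun m hm => by omega⟩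
          · refine ⟨j, by omega, hxj, fun i hi hxθ => ?_⟩
            rcases hi.1.eq_or_lt with h | h
            · exact hx ⟨i, h.symm, hxθ⟩
            · exact hxi i ⟨h, hi.2⟩ hxθ
        · exact ⟨j, hj.ge, hxj, fun m hm => by omega⟩
      · rintro ⟨j, hj, hxj, hxi⟩
        rcases hj.eq_or_lt with h | h
        · exact Or.inr ⟨j, h.symm, hxj⟩
        · exact Or.inl ⟨⟨j, h, hxj, fun i hi => hxi i ⟨by omega, hi.2⟩⟩,
            fun i hi hxθ => (hxi i ⟨hi.ge, by omega⟩ hxθ).elim⟩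
  · intro j j' hj hj' hne
    rw [Set.disjoint_left]
    rintro x ⟨hxj, hnj⟩ ⟨hxj', hnj'⟩
    simp only [mem_iUnion, exists_prop, not_exists, not_and] at hnj hnj'
    rcases lt_trichotomy (lvl j) (lvl j') with h | h | h
    · exact hnj' j ⟨hj, h⟩ (hsub j hxj)
    · exact Set.disjoint_left.mp (hD j j' hne (by simp [h])) (hsub_sq j hxj) (hsub_sq j' hxj')
    · exact hnj j' ⟨hj', h⟩ (hsub j' hxj')
end

section
/- Assume hypothesis (D). Then for every k ∈ {0, …, K} one has the inclusion ⋃_{j ∈ J, lvl(j) ≥ k} E^j ⊆ E_k. -/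
open Metric Set MeasureTheory

/-- Under hypothesis (D), for every `k ∈ {0, …, K}` one has
`⋃_{j ∈ J, lvl j ≥ k} E^j ⊆ E_k`, where `E^j = B_j ∖ ⋃_{lvl i < lvl j} B_{i,θ}`. -/
theorem stmt_1
    (d : ℕ) (hd : 1 ≤ d)
    (θ : ℝ) (hθ : 1 < θ)
    (K : ℕ)
    (J : Type) [Fintype J]
    (lvl : J → ℕ) (hlvl : ∀ j, lvl j ≤ K)
    (z : J → EuclideanSpace ℝ (Fin d)) (r : J → ℝ) (hr : ∀ j, 0 < r j)
    (E : ℕ → Set (EuclideanSpace ℝ (Fin d)))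
    (hEtop : E (K + 1) = ∅)
    (hErec : ∀ k ≤ K, E k =
      (E (k + 1) \ ⋃ j, ⋃ (_ : lvl j = k),
          (ball (z j) (θ * r j) \ ball (z j) (r j)))
        ∪ ⋃ j, ⋃ (_ : lvl j = k), ball (z j) (r j))
    (hD : ∀ i j : J, i ≠ j → |(lvl i : ℤ) - (lvl j : ℤ)| ≤ 1 →
      Disjoint (ball (z i) (θ ^ 2 * r i)) (ball (z j) (θ ^ 2 * r j))) :
    ∀ k ≤ K,
      (⋃ j, ⋃ (_ : k ≤ lvl j),
        (ball (z j) (r j) \ ⋃ i, ⋃ (_ : lvl i < lvl j), ball (z i) (θ * r i)))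
      ⊆ E k := by
  intro k hk x hx
  simp only [mem_iUnion, exists_prop] at hx
  obtain ⟨j, hkj, hxj, hxout⟩ := hx
  simp only [mem_iUnion, exists_prop, not_exists, not_and] at hxout
  clear hk
  induction hkj using Nat.decreasingInduction with
  | self =>
    rw [hErec _ (hlvl j)]
    exact Or.inr (mem_iUnion₂.2 ⟨j, rfl, hxj⟩)
  | of_succ m hm ih =>
    rw [hErec m (hm.le.trans (hlvl j))]
    refine Or.inl ⟨ih, ?_⟩
    rw [mem_iUnion₂]
    rintro ⟨i, rfl, hi, -⟩
    exact hxout i hm hi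
end

section
/- Assume hypothesis (D), let H ⊆ ℝ^d be a set satisfying H ∩ B_{j,θ} = ∅ for every j ∈ J, and set Ẽ := E ∪ H. Then for every j ∈ J with lvl(j) = k one has the identity E^j = (Ẽ ∩ B_j) ∖ ⋃_{i ∈ J, lvl(i) ≤ k−2} E^i. -/
open Metric Set MeasureTheory

/-- A point outside every dilated ball of level below `n` has the same membership in `E 0`
and in `E n`: the annuli and balls of those levels do not affect it. -/
theorem mem_zero_iff_of_forall_notMem_dilated {α J : Type*} {lvl : J → ℕ} {B D : J → Set α}
    {E : ℕ → Set α} {K : ℕ} (hBD : ∀ j, B j ⊆ D j)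
    (hE : ∀ k ≤ K, E k =
      (E (k + 1) \ ⋃ j, ⋃ (_ : lvl j = k), (D j \ B j)) ∪ ⋃ j, ⋃ (_ : lvl j = k), B j)
    {x : α} {n : ℕ} (hn : n ≤ K + 1) (hx : ∀ i, lvl i < n → x ∉ D i) :
    x ∈ E 0 ↔ x ∈ E n := by
  induction n with
  | zero => rfl
  | succ n ih =>
    have hD : ∀ i, lvl i = n → x ∉ D i := fun i hi => hx i (by omega)
    have hB : ∀ i, lvl i = n → x ∉ B i := fun i hi h => hD i hi (hBD i h)
    rw [ih (by omega) fun i hi => hx i (by omega), hE n (by omega)]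
    simp only [mem_union, mem_sdiff, mem_iUnion, exists_prop]
    grind

/-- Under hypothesis (D), if `H` avoids all dilated balls `B_{j,θ}` and
`Ẽ := E ∪ H`, then for every `j` with `lvl j = k`,
`E^j = (Ẽ ∩ B_j) ∖ ⋃_{lvl i ≤ k−2} E^i`. -/
theorem stmt_2
    (d : ℕ) (hd : 1 ≤ d)
    (θ : ℝ) (hθ : 1 < θ)
    (K : ℕ)
    (J : Type) [Fintype J]
    (lvl : J → ℕ) (hlvl : ∀ j, lvl j ≤ K)
    (z : J → EuclideanSpace ℝ (Fin d)) (r : J → ℝ) (hr : ∀ j, 0 < r j)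
    (E : ℕ → Set (EuclideanSpace ℝ (Fin d)))
    (hEtop : E (K + 1) = ∅)
    (hErec : ∀ k ≤ K, E k =
      (E (k + 1) \ ⋃ j, ⋃ (_ : lvl j = k),
          (ball (z j) (θ * r j) \ ball (z j) (r j)))
        ∪ ⋃ j, ⋃ (_ : lvl j = k), ball (z j) (r j))
    (hD : ∀ i j : J, i ≠ j → |(lvl i : ℤ) - (lvl j : ℤ)| ≤ 1 →
      Disjoint (ball (z i) (θ ^ 2 * r i)) (ball (z j) (θ ^ 2 * r j)))
    (H : Set (EuclideanSpace ℝ (Fin d)))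
    (hH : ∀ j : J, H ∩ ball (z j) (θ * r j) = ∅) :
    ∀ j : J,
      (ball (z j) (r j) \ ⋃ i, ⋃ (_ : lvl i < lvl j), ball (z i) (θ * r i))
      = ((E 0 ∪ H) ∩ ball (z j) (r j)) \
          ⋃ i, ⋃ (_ : lvl i + 2 ≤ lvl j),
            (ball (z i) (r i) \ ⋃ m, ⋃ (_ : lvl m < lvl i), ball (z m) (θ * r m)) := by
  have hBD : ∀ j, ball (z j) (r j) ⊆ ball (z j) (θ * r j) := fun j =>
    ball_subset_ball (by nlinarith [hr j])
  have hDD : ∀ j, ball (z j) (θ * r j) ⊆ ball (z j) (θ ^ 2 * r j) := fun j =>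
    ball_subset_ball (mul_le_mul_of_nonneg_right (by nlinarith) (hr j).le)
  have hsep : ∀ i j x, |(lvl i : ℤ) - (lvl j : ℤ)| ≤ 1 → x ∈ ball (z i) (θ * r i) →
      x ∈ ball (z j) (θ * r j) → i = j := fun i j x hij hi hj => by
    by_contra hne
    exact disjoint_left.mp (hD i j hne hij) (hDD i hi) (hDD j hj)
  intro j
  ext x
  simp only [mem_sdiff, mem_inter_iff, mem_union, mem_iUnion, exists_prop, not_exists, not_and,
    not_forall, not_not]
  constructor
  · rintro ⟨hxj, hx⟩
    refine ⟨⟨Or.inl ?_, hxj⟩, fun i hi hxi => absurd (hBD i hxi) (hx i (by omega))⟩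
    have hj := hlvl j
    rw [mem_zero_iff_of_forall_notMem_dilated hBD hErec (by omega) hx, hErec _ hj]
    exact Or.inr (mem_iUnion₂.mpr ⟨j, rfl, hxj⟩)
  · rintro ⟨⟨hxE, hxj⟩, hx⟩
    refine ⟨hxj, ?_⟩
    have hxE0 : x ∈ E 0 := hxE.resolve_right fun hxH =>
      eq_empty_iff_forall_notMem.mp (hH j) x ⟨hxH, hBD j hxj⟩
    by_contra! hbad
    obtain ⟨i, ⟨hij, hxi⟩, hmin⟩ :=
      (measure lvl).wf.has_min {i | lvl i < lvl j ∧ x ∈ ball (z i) (θ * r i)} hbad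
    have hlow : ∀ m, lvl m < lvl i → x ∉ ball (z m) (θ * r m) := fun m hm hxm =>
      hmin m ⟨hm.trans hij, hxm⟩ hm
    have hgap : lvl i + 2 ≤ lvl j := by
      by_contra! hlt
      have := hsep i j x (abs_le.mpr ⟨by omega, by omega⟩) hxi (hBD j hxj)
      subst this
      exact hij.false
    have hxi' : x ∉ ball (z i) (r i) := fun h => by
      obtain ⟨m, hm, hxm⟩ := hx i hgap h
      exact hlow m hm hxm
    have hK := hlvl i
    rw [mem_zero_iff_of_forall_notMem_dilated hBD hErec (by omega) hlow, hErec _ hK] at hxE0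
    rcases hxE0 with ⟨-, h⟩ | h
    · exact h (mem_iUnion₂.mpr ⟨i, rfl, hxi, hxi'⟩)
    · obtain ⟨m, hm, hxm⟩ := mem_iUnion₂.mp h
      obtain rfl := hsep m i x (by simp [hm]) (hBD m hxm) hxi
      exact hxi' hxm
end

section
/- Assume hypothesis (D). Then for all j, i ∈ J with lvl(j) = k and lvl(i) ≥ k − 1 one has E^i ∩ A_j ∩ E_{k+1} = ∅. -/
open Metric Set MeasureTheory

/-- Under hypothesis (D), for all `j, i ∈ J` with `lvl j = k` and
`lvl i ≥ k − 1`, one has `E^i ∩ A_j ∩ E_{k+1} = ∅`. -/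
theorem stmt_3
    (d : ℕ) (hd : 1 ≤ d)
    (θ : ℝ) (hθ : 1 < θ)
    (K : ℕ)
    (J : Type) [Fintype J]
    (lvl : J → ℕ) (hlvl : ∀ j, lvl j ≤ K)
    (z : J → EuclideanSpace ℝ (Fin d)) (r : J → ℝ) (hr : ∀ j, 0 < r j)
    (E : ℕ → Set (EuclideanSpace ℝ (Fin d)))
    (hEtop : E (K + 1) = ∅)
    (hErec : ∀ k ≤ K, E k =
      (E (k + 1) \ ⋃ j, ⋃ (_ : lvl j = k),
          (ball (z j) (θ * r j) \ ball (z j) (r j)))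
        ∪ ⋃ j, ⋃ (_ : lvl j = k), ball (z j) (r j))
    (hD : ∀ i j : J, i ≠ j → |(lvl i : ℤ) - (lvl j : ℤ)| ≤ 1 →
      Disjoint (ball (z i) (θ ^ 2 * r i)) (ball (z j) (θ ^ 2 * r j))) :
    ∀ j i : J, lvl j ≤ lvl i + 1 →
      (ball (z i) (r i) \ ⋃ m, ⋃ (_ : lvl m < lvl i), ball (z m) (θ * r m))
        ∩ (ball (z j) (θ * r j) \ ball (z j) (r j))
        ∩ E (lvl j + 1) = ∅ := by
  intro j i hji
  rw [Set.eq_empty_iff_forall_notMem]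
  rintro x ⟨⟨⟨hxi, hxlow⟩, hxj, hxj'⟩, -⟩
  have hle : lvl i ≤ lvl j := by
    by_contra! h
    exact hxlow (mem_iUnion₂.2 ⟨j, h, hxj⟩)
  have hij : i ≠ j := by
    rintro rfl
    exact hxj' hxi
  have habs : |(lvl i : ℤ) - (lvl j : ℤ)| ≤ 1 := by
    rw [abs_le]
    omega
  have hi : r i ≤ θ ^ 2 * r i := le_mul_of_one_le_left (hr i).le (one_le_pow₀ hθ.le)
  have hj : θ * r j ≤ θ ^ 2 * r j :=
    mul_le_mul_of_nonneg_right (le_self_pow₀ hθ.le two_ne_zero) (hr j).le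
  exact Set.disjoint_left.1 (hD i j hij habs) (ball_subset_ball hi hxi) (ball_subset_ball hj hxj)
end

section
/- Assume hypothesis (D), let H ⊆ ℝ^d be a set satisfying H ∩ B_{j,θ} = ∅ for every j ∈ J, and set Ẽ := E ∪ H. Then for every j ∈ J with lvl(j) = k one has A_j ∩ E_{k+1} ∩ Ẽ = A_j ∩ E_{k+1} ∩ ⋃_{i ∈ J, lvl(i) ≤ k−2} E^i. -/
open Metric Set MeasureTheory

/-- Membership in the sets of the annulus recursion does not change across levels at which the
point lies in no outer set `V j`, provided the inner sets satisfy `U j ⊆ V j`. -/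
theorem mem_zero_iff_mem_of_forall_notMem {X J : Type*} {K : ℕ} {lvl : J → ℕ}
    {U V : J → Set X} {E : ℕ → Set X} (hUV : ∀ j, U j ⊆ V j)
    (hE : ∀ k ≤ K, E k = (E (k + 1) \ ⋃ j, ⋃ (_ : lvl j = k), (V j \ U j))
      ∪ ⋃ j, ⋃ (_ : lvl j = k), U j)
    {x : X} {l : ℕ} (hl : l ≤ K) (hx : ∀ m, lvl m < l → x ∉ V m) :
    x ∈ E 0 ↔ x ∈ E l := by
  induction l with
  | zero => rfl
  | succ n ih =>
    rw [ih (by omega) fun m hm => hx m (by omega), hE n (by omega)]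
    have hV : ∀ m, lvl m = n → x ∉ V m := fun m hm => hx m (by omega)
    simp only [mem_union, mem_sdiff, mem_iUnion, exists_prop, not_exists, not_and]
    constructor
    · rintro (h | ⟨m, hm, hxm⟩)
      · exact h.1
      · exact absurd (hUV m hxm) (hV m hm)
    · exact fun h => Or.inl ⟨h, fun m hm hxm => absurd hxm (hV m hm)⟩

/-- Under hypothesis (D), if `H` avoids all dilated balls `B_{j,θ}` and
`Ẽ := E ∪ H`, then for every `j` with `lvl j = k`,
`A_j ∩ E_{k+1} ∩ Ẽ = A_j ∩ E_{k+1} ∩ ⋃_{lvl i ≤ k−2} E^i`. -/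
theorem stmt_4
    (d : ℕ) (hd : 1 ≤ d)
    (θ : ℝ) (hθ : 1 < θ)
    (K : ℕ)
    (J : Type) [Fintype J]
    (lvl : J → ℕ) (hlvl : ∀ j, lvl j ≤ K)
    (z : J → EuclideanSpace ℝ (Fin d)) (r : J → ℝ) (hr : ∀ j, 0 < r j)
    (E : ℕ → Set (EuclideanSpace ℝ (Fin d)))
    (hEtop : E (K + 1) = ∅)
    (hErec : ∀ k ≤ K, E k =
      (E (k + 1) \ ⋃ j, ⋃ (_ : lvl j = k),
          (ball (z j) (θ * r j) \ ball (z j) (r j)))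
        ∪ ⋃ j, ⋃ (_ : lvl j = k), ball (z j) (r j))
    (hD : ∀ i j : J, i ≠ j → |(lvl i : ℤ) - (lvl j : ℤ)| ≤ 1 →
      Disjoint (ball (z i) (θ ^ 2 * r i)) (ball (z j) (θ ^ 2 * r j)))
    (H : Set (EuclideanSpace ℝ (Fin d)))
    (hH : ∀ j : J, H ∩ ball (z j) (θ * r j) = ∅) :
    ∀ j : J,
      (ball (z j) (θ * r j) \ ball (z j) (r j)) ∩ E (lvl j + 1) ∩ (E 0 ∪ H)
      = (ball (z j) (θ * r j) \ ball (z j) (r j)) ∩ E (lvl j + 1) ∩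
          ⋃ i, ⋃ (_ : lvl i + 2 ≤ lvl j),
            (ball (z i) (r i) \ ⋃ m, ⋃ (_ : lvl m < lvl i), ball (z m) (θ * r m)) := by
  have hUV : ∀ j, ball (z j) (r j) ⊆ ball (z j) (θ * r j) := fun j =>
    ball_subset_ball (by nlinarith [hr j])
  have hVW : ∀ j, ball (z j) (θ * r j) ⊆ ball (z j) (θ ^ 2 * r j) := fun j =>
    ball_subset_ball (mul_le_mul_of_nonneg_right (by nlinarith) (hr j).le)
  have hsep : ∀ i j x, x ∈ ball (z i) (θ * r i) → x ∈ ball (z j) (θ * r j) →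
      |(lvl i : ℤ) - (lvl j : ℤ)| ≤ 1 → i = j := by
    intro i j x hi hj hij
    by_contra hne
    exact Set.disjoint_left.1 (hD i j hne hij) (hVW i hi) (hVW j hj)
  intro j
  ext x
  simp only [mem_inter_iff, and_congr_right_iff]
  rintro ⟨⟨hxj, hxj'⟩, -⟩
  have hxH : x ∉ H := fun h => by
    have : x ∈ H ∩ ball (z j) (θ * r j) := ⟨h, hxj⟩
    rwa [hH j] at this
  simp only [mem_union, hxH, or_false, mem_iUnion, mem_sdiff, exists_prop, not_exists, not_and]
  constructor
  · intro hx0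
    have hex : ∃ l, ∃ i, lvl i = l ∧ x ∈ ball (z i) (θ * r i) := ⟨_, j, rfl, hxj⟩
    classical
    obtain ⟨i, hil, hxi⟩ := Nat.find_spec hex
    have hmin : ∀ m, lvl m < lvl i → x ∉ ball (z m) (θ * r m) := fun m hm hxm =>
      Nat.find_min hex (hil ▸ hm) ⟨m, rfl, hxm⟩
    have hij : lvl i ≤ lvl j := not_lt.1 fun h => hmin j h hxj
    have hxE : x ∈ E (lvl i) :=
      (mem_zero_iff_mem_of_forall_notMem hUV hErec (hlvl i) hmin).1 hx0
    have hxU : x ∈ ball (z i) (r i) := by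
      rw [hErec _ (hlvl i)] at hxE
      simp only [mem_union, mem_sdiff, mem_iUnion, exists_prop, not_exists, not_and] at hxE
      rcases hxE with h | ⟨m, hm, hxm⟩
      · exact not_not.1 (h.2 i rfl hxi)
      · rwa [← hsep m i x (hUV m hxm) hxi (by simp [hm])]
    refine ⟨i, ?_, hxU, hmin⟩
    by_contra hlt
    have hji : i = j := hsep i j x hxi hxj (by rw [abs_le]; omega)
    exact hxj' (hji ▸ hxU)
  · rintro ⟨i, -, hxi, hmin⟩
    rw [mem_zero_iff_mem_of_forall_notMem hUV hErec (hlvl i) hmin, hErec _ (hlvl i)]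
    exact Or.inr (mem_iUnion₂.2 ⟨i, rfl, hxi⟩)
end

section
/- For every dimension d ≥ 1 and every θ > 1 there exists a constant c = c(d, θ) > 0 with the following property. Assume hypothesis (D), and assume in addition: (i) for every j ∈ J, the ball B(z_j, r_j/θ) is NOT contained in E_{lvl(j)+1}; (ii) for every j ∈ J, B(z_j, r_j/√θ) ⊆ E^j; (iii) for all i, j ∈ J with lvl(i) ≥ lvl(j) + 2 one has (θ − 1) r_i ≥ 3 θ r_j. Then for every j ∈ J the Lebesgue measure satisfies |E^j ∖ E_{lvl(j)+1}| ≥ c |B_j|. -/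
open Metric Set MeasureTheory

section CarvedSets

variable {X J : Type*} [PseudoMetricSpace X] {θ : ℝ} {K : ℕ} {lvl : J → ℕ} {z : J → X} {r : J → ℝ}
  {E : ℕ → Set X}

/-- A point of `E p` that lies in none of the balls of levels in `[p, q)` lies in `E q`. -/
theorem mem_of_forall_notMem_ball
    (hE : ∀ k ≤ K, E k =
      (E (k + 1) \ ⋃ j, ⋃ (_ : lvl j = k), (ball (z j) (θ * r j) \ ball (z j) (r j)))
        ∪ ⋃ j, ⋃ (_ : lvl j = k), ball (z j) (r j))
    {y : X} {p q : ℕ} (hpq : p ≤ q) (hq : q ≤ K + 1) (hy : y ∈ E p)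
    (h : ∀ i, p ≤ lvl i → lvl i < q → y ∉ ball (z i) (r i)) : y ∈ E q := by
  induction q, hpq using Nat.le_induction with
  | base => exact hy
  | succ m hm ih =>
    have hmem := ih (by omega) fun i h₁ h₂ => h i h₁ (by omega)
    rw [hE m (by omega)] at hmem
    rcases hmem with hmem | hmem
    · exact hmem.1
    · simp only [mem_iUnion] at hmem
      obtain ⟨i, hi, hyi⟩ := hmem
      exact absurd hyi (h i (by omega) (by omega))

/-- A point of `E q` that lies in none of the dilated balls of levels in `[p, q)` lies in `E p`. -/
theorem mem_of_forall_notMem_dilated_ball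
    (hE : ∀ k ≤ K, E k =
      (E (k + 1) \ ⋃ j, ⋃ (_ : lvl j = k), (ball (z j) (θ * r j) \ ball (z j) (r j)))
        ∪ ⋃ j, ⋃ (_ : lvl j = k), ball (z j) (r j))
    {y : X} {p q : ℕ} (hpq : p ≤ q) (hq : q ≤ K + 1) (hy : y ∈ E q)
    (h : ∀ i, p ≤ lvl i → lvl i < q → y ∉ ball (z i) (θ * r i)) : y ∈ E p := by
  induction q, hpq using Nat.le_induction with
  | base => exact hy
  | succ m hm ih =>
    refine ih (by omega) ?_ fun i h₁ h₂ => h i h₁ (by omega)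
    rw [hE m (by omega)]
    refine Or.inl ⟨hy, ?_⟩
    simp only [mem_iUnion]
    rintro ⟨i, hi, hyi, -⟩
    exact h i (by omega) (by omega) hyi

end CarvedSets

/-- A point of a sufficiently thick annulus is within distance `ρ` of the center of a ball of
radius `ρ` contained in the annulus. -/
theorem exists_ball_subset_annulus {V : Type*} [NormedAddCommGroup V] [NormedSpace ℝ V]
    {x w : V} {a b ρ : ℝ} (ha : 0 < a) (hρ : 0 < ρ) (hab : 4 * ρ ≤ b - a)
    (hxa : a ≤ dist x w) (hxb : dist x w < b) :
    ∃ x', dist x' x ≤ ρ ∧ ball x' ρ ⊆ ball w b \ ball w a := by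
  have hpos : 0 < dist x w := ha.trans_le hxa
  obtain ⟨s, hs, hsa, hsb⟩ : ∃ s : ℝ, |s - dist x w| ≤ ρ ∧ a + ρ ≤ s ∧ s ≤ b - ρ := by
    rcases le_total (dist x w) ((a + b) / 2) with h | h
    · exact ⟨dist x w + ρ, by simp [abs_of_pos hρ], by linarith, by linarith⟩
    · exact ⟨dist x w - ρ, by simp [abs_of_pos hρ], by linarith, by linarith⟩
  have hs0 : 0 < s := by linarith
  have hnorm : ‖x - w‖ = dist x w := (dist_eq_norm x w).symm
  have hw : dist (w + (s / dist x w) • (x - w)) w = s := by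
    rw [dist_eq_norm, add_sub_cancel_left, norm_smul, hnorm, Real.norm_of_nonneg (by positivity)]
    field_simp
  have hx : dist (w + (s / dist x w) • (x - w)) x = |s - dist x w| := by
    have : w + (s / dist x w) • (x - w) - x = ((s - dist x w) / dist x w) • (x - w) := by
      rw [sub_div, div_self hpos.ne', sub_smul, one_smul]
      abel
    rw [dist_eq_norm, this, norm_smul, hnorm, Real.norm_eq_abs, abs_div, abs_of_pos hpos]
    field_simp
  refine ⟨_, hx.trans_le hs, fun y hy => ?_⟩
  rw [mem_ball] at hy
  have h₁ := dist_triangle y (w + (s / dist x w) • (x - w)) w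
  have h₂ := dist_triangle_left (w + (s / dist x w) • (x - w)) w y
  refine ⟨mem_ball.2 (by linarith), fun h => ?_⟩
  rw [mem_ball] at h
  linarith

/-- If `x ∉ E (lvl j + 1)` lies in `B_j`, then within distance `ρ` of `x` there is the center of
a ball of radius `ρ` whose intersection with `B_j` misses `E (lvl j + 1)`. -/
theorem exists_ball_inter_disjoint {V J : Type*} [NormedAddCommGroup V] [NormedSpace ℝ V]
    {θ : ℝ} (hθ : 1 < θ) {K : ℕ} {lvl : J → ℕ} (hlvl : ∀ j, lvl j ≤ K)
    {z : J → V} {r : J → ℝ} (hr : ∀ j, 0 < r j) {E : ℕ → Set V} (hEK : E (K + 1) = ∅)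
    (hE : ∀ k ≤ K, E k =
      (E (k + 1) \ ⋃ j, ⋃ (_ : lvl j = k), (ball (z j) (θ * r j) \ ball (z j) (r j)))
        ∪ ⋃ j, ⋃ (_ : lvl j = k), ball (z j) (r j))
    (hD : ∀ i j : J, i ≠ j → |(lvl i : ℤ) - (lvl j : ℤ)| ≤ 1 →
      Disjoint (ball (z i) (θ ^ 2 * r i)) (ball (z j) (θ ^ 2 * r j)))
    (hgap : ∀ i j : J, lvl j + 2 ≤ lvl i → (θ - 1) * r i ≥ 3 * θ * r j)
    (j : J) {ρ : ℝ} (hρ : 0 < ρ) (hρj : 2 * ρ ≤ r j) {x : V} (hxj : x ∈ ball (z j) (r j))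
    (hx : x ∉ E (lvl j + 1)) :
    ∃ x', dist x' x ≤ ρ ∧ ∀ y ∈ ball x' ρ, y ∈ ball (z j) (r j) → y ∉ E (lvl j + 1) := by
  have hsub : ∀ i, ball (z i) (r i) ⊆ ball (z i) (θ * r i) := fun i =>
    ball_subset_ball (by nlinarith [hr i])
  have hsub₂ : ∀ i, ball (z i) (θ * r i) ⊆ ball (z i) (θ ^ 2 * r i) := fun i =>
    ball_subset_ball (by nlinarith [mul_pos (zero_lt_one.trans hθ) (hr i)])
  have hnext : ∀ i, lvl i = lvl j + 1 → ∀ y ∈ ball (z j) (r j), y ∉ ball (z i) (θ * r i) := by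
    intro i hi y hyj hyi
    refine (hD i j (by rintro rfl; omega) ?_).le_bot ⟨hsub₂ i hyi, hsub₂ j (hsub j hyj)⟩
    rw [hi]
    simp
  have hwide : ∀ i, lvl j + 2 ≤ lvl i → 3 * r j ≤ (θ - 1) * r i := fun i hi => by
    nlinarith [hgap i j hi, hr j]
  have havoid : ∀ i, lvl j + 1 ≤ lvl i → x ∉ ball (z i) (θ * r i) →
      ∀ y, dist y x ≤ 2 * ρ → y ∈ ball (z j) (r j) → y ∉ ball (z i) (r i) := by
    intro i hi hxi y hyx hyj hyi
    rcases hi.eq_or_lt with hi | hi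
    · exact hnext i hi.symm y hyj (hsub i hyi)
    · rw [mem_ball, not_lt] at hxi
      rw [mem_ball] at hyi
      have := dist_triangle_left x (z i) y
      linarith [hwide i hi, hr j]
  by_cases hex : ∃ m i, lvl i = m ∧ lvl j + 1 ≤ lvl i ∧ x ∈ ball (z i) (θ * r i)
  · classical
    obtain ⟨i, him, hji, hxi⟩ := Nat.find_spec hex
    have hmin : ∀ i', lvl j + 1 ≤ lvl i' → lvl i' < lvl i → x ∉ ball (z i') (θ * r i') :=
      fun i' h₁ h₂ h₃ => Nat.find_min hex (him ▸ h₂) ⟨i', rfl, h₁, h₃⟩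
    have hlt : lvl j + 2 ≤ lvl i := by
      rcases hji.eq_or_lt with h | h
      · exact absurd hxi (hnext i h.symm x hxj)
      · exact h
    have hxi' : x ∉ ball (z i) (r i) := fun h => by
      refine hx (mem_of_forall_notMem_dilated_ball hE hji (by linarith [hlvl i]) ?_ hmin)
      rw [hE _ (hlvl i)]
      exact Or.inr (mem_iUnion₂.2 ⟨i, rfl, h⟩)
    obtain ⟨x', hx', hann⟩ := exists_ball_subset_annulus (hr i) hρ
      (by linarith [hwide i hlt, hr j]) (not_lt.1 hxi') (mem_ball.1 hxi)
    refine ⟨x', hx', fun y hy hyj hyE => ?_⟩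
    have hyx : dist y x ≤ 2 * ρ := by
      linarith [dist_triangle y x' x, mem_ball.1 hy]
    have hyi := mem_of_forall_notMem_ball hE hji (by linarith [hlvl i]) hyE
      fun i' h₁ h₂ => havoid i' h₁ (hmin i' h₁ h₂) y hyx hyj
    rw [hE _ (hlvl i)] at hyi
    rcases hyi with hyi | hyi
    · exact hyi.2 (mem_iUnion₂.2 ⟨i, rfl, hann hy⟩)
    · obtain ⟨i', hi', hyi'⟩ := mem_iUnion₂.1 hyi
      rcases eq_or_ne i' i with rfl | hne
      · exact (hann hy).2 hyi'
      · exact (hD i' i hne (by simp [hi'])).le_bot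
          ⟨hsub₂ i' (hsub i' hyi'), hsub₂ i (hann hy).1⟩
  · push Not at hex
    refine ⟨x, by simpa using hρ.le, fun y hy hyj hyE => ?_⟩
    have := mem_of_forall_notMem_ball hE (by linarith [hlvl j]) le_rfl hyE
      fun i h₁ _ => havoid i h₁ (hex _ i rfl h₁) y (by linarith [mem_ball.1 hy]) hyj
    rw [hEK] at this
    exact this

/-- For every dimension `d ≥ 1` and every `θ > 1` there is `c = c(d, θ) > 0`:
under hypothesis (D) and the additional hypotheses (i) `B(z_j, r_j/θ) ⊄ E_{lvl(j)+1}`,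
(ii) `B(z_j, r_j/√θ) ⊆ E^j`, (iii) `(θ − 1) r_i ≥ 3 θ r_j` whenever `lvl i ≥ lvl j + 2`,
one has `|E^j ∖ E_{lvl(j)+1}| ≥ c |B_j|` for every `j ∈ J`. -/
theorem stmt_5
    (d : ℕ) (hd : 1 ≤ d) (θ : ℝ) (hθ : 1 < θ) :
    ∃ c : ℝ, 0 < c ∧
      ∀ (K : ℕ) (J : Type) (_ : Fintype J)
        (lvl : J → ℕ) (_ : ∀ j, lvl j ≤ K)
        (z : J → EuclideanSpace ℝ (Fin d)) (r : J → ℝ) (_ : ∀ j, 0 < r j)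
        (E : ℕ → Set (EuclideanSpace ℝ (Fin d)))
        (_ : E (K + 1) = ∅)
        (_ : ∀ k ≤ K, E k =
          (E (k + 1) \ ⋃ j, ⋃ (_ : lvl j = k),
              (ball (z j) (θ * r j) \ ball (z j) (r j)))
            ∪ ⋃ j, ⋃ (_ : lvl j = k), ball (z j) (r j))
        (_ : ∀ i j : J, i ≠ j → |(lvl i : ℤ) - (lvl j : ℤ)| ≤ 1 →
          Disjoint (ball (z i) (θ ^ 2 * r i)) (ball (z j) (θ ^ 2 * r j)))
        (_ : ∀ j : J, ¬ ball (z j) (r j / θ) ⊆ E (lvl j + 1))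
        (_ : ∀ j : J, ball (z j) (r j / Real.sqrt θ) ⊆
          (ball (z j) (r j) \ ⋃ i, ⋃ (_ : lvl i < lvl j), ball (z i) (θ * r i)))
        (_ : ∀ i j : J, lvl j + 2 ≤ lvl i → (θ - 1) * r i ≥ 3 * θ * r j),
        ∀ j : J,
          ENNReal.ofReal c * volume (ball (z j) (r j)) ≤
            volume ((ball (z j) (r j) \ ⋃ i, ⋃ (_ : lvl i < lvl j),
                ball (z i) (θ * r i)) \ E (lvl j + 1)) := by
  have hsqrt : 1 < Real.sqrt θ := by simpa using Real.sqrt_lt_sqrt zero_le_one hθ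
  have hsq : Real.sqrt θ < θ := by nlinarith [Real.mul_self_sqrt (zero_le_one.trans hθ.le)]
  have hθ0 : 0 < θ := zero_lt_one.trans hθ
  have hinv : θ⁻¹ < (Real.sqrt θ)⁻¹ := inv_strictAnti₀ (by linarith) hsq
  have hinv₁ : (Real.sqrt θ)⁻¹ < 1 := inv_lt_one_of_one_lt₀ hsqrt
  have hinv₀ : 0 < θ⁻¹ := inv_pos.2 hθ0
  obtain ⟨t, ht⟩ : ∃ t, t = ((Real.sqrt θ)⁻¹ - θ⁻¹) / 2 := ⟨_, rfl⟩
  have ht0 : 0 < t := by linarith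
  refine ⟨t ^ d, pow_pos ht0 d, ?_⟩
  intro K J _ lvl hlvl z r hr E hEK hE hD hi hii hgap j
  obtain ⟨x, hxj, hxE⟩ := not_subset.1 (hi j)
  have hxj' : x ∈ ball (z j) (r j) :=
    ball_subset_ball (div_le_self (hr j).le hθ.le) hxj
  obtain ⟨x', hx', hball⟩ := exists_ball_inter_disjoint hθ hlvl hr hEK hE hD hgap j
    (mul_pos ht0 (hr j)) (by nlinarith [hr j]) hxj' hxE
  have hsub : ball x' (t * r j) ⊆ ball (z j) (r j / Real.sqrt θ) := by
    refine ball_subset_ball' ?_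
    have h₁ := dist_triangle x' x (z j)
    have h₂ := mem_ball.1 hxj
    rw [div_eq_mul_inv] at h₂ ⊢
    have h₃ : r j * (Real.sqrt θ)⁻¹ = t * r j + t * r j + r j * θ⁻¹ := by rw [ht]; ring
    linarith
  have hvol : ENNReal.ofReal (t ^ d) * volume (ball (z j) (r j)) = volume (ball x' (t * r j)) := by
    rw [Measure.addHaar_ball_mul_of_pos _ _ ht0, finrank_euclideanSpace_fin,
      Measure.addHaar_ball_center volume (z j)]
  rw [hvol]
  exact measure_mono fun y hy => ⟨hii j (hsub hy), hball y hy (hii j (hsub hy)).1⟩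
end

section
/- Assume hypothesis (D) and assume: (i) for every p ∈ J, the ball B(z_p, r_p/θ) is NOT contained in E_{lvl(p)+1}; (ii) for all i, j ∈ J with lvl(i) ≥ lvl(j) + 2 one has (θ − 1) r_i ≥ 3 θ r_j. Let j ∈ J with lvl(j) = k and let i ∈ J with lvl(i) = l ≥ k + 2 be such that A_i ∩ B(z_j, r_j/θ) ≠ ∅, and suppose l is the minimal such level above k, i.e. A_{i'} ∩ B(z_j, r_j/θ) = ∅ for every i' ∈ J with k + 1 ≤ lvl(i') < l. Then A_i ∩ B(z_j, r_j/√θ) ∩ E_{k+1} = ∅. -/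
open Metric Set MeasureTheory

/-- A point lies in the set obtained by removing annuli `A q` and adding balls `B q`, from the
highest level down to level `n`, iff it lies in some ball of level at least `n` and in no annulus
of a level between `n` and that of the ball. -/
theorem mem_recursive_set_iff {X J : Type*} {K : ℕ} {lvl : J → ℕ} (hlvl : ∀ j, lvl j ≤ K)
    {A B : J → Set X} {E : ℕ → Set X} (hEtop : E (K + 1) = ∅)
    (hErec : ∀ k ≤ K, E k =
      (E (k + 1) \ ⋃ j, ⋃ (_ : lvl j = k), A j) ∪ ⋃ j, ⋃ (_ : lvl j = k), B j)
    {n : ℕ} (hn : n ≤ K + 1) (x : X) :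
    x ∈ E n ↔ ∃ p, n ≤ lvl p ∧ x ∈ B p ∧ ∀ q, n ≤ lvl q → lvl q < lvl p → x ∉ A q := by
  induction hn using Nat.decreasingInduction with
  | self =>
    rw [hEtop]
    refine iff_of_false (notMem_empty x) ?_
    rintro ⟨p, hp, -⟩
    have := hlvl p
    omega
  | of_succ n hn ih =>
    rw [hErec n (by omega)]
    simp only [mem_union, mem_sdiff, mem_iUnion, exists_prop, ih, not_exists, not_and]
    constructor
    · rintro (⟨⟨p, hp, hxp, hA⟩, hAn⟩ | ⟨p, rfl, hxp⟩)
      · refine ⟨p, by omega, hxp, fun q hq hqp => ?_⟩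
        rcases hq.eq_or_lt with h | h
        · exact hAn q h.symm
        · exact hA q h hqp
      · exact ⟨p, le_rfl, hxp, fun q hq hqp => absurd hq (not_le.2 hqp)⟩
    · rintro ⟨p, hp, hxp, hA⟩
      rcases hp.eq_or_lt with h | h
      · exact Or.inr ⟨p, h.symm, hxp⟩
      · exact Or.inl ⟨⟨p, h, hxp, fun q hq => hA q (by omega)⟩,
          fun q hq => hA q hq.ge (by omega)⟩

/-- If the annulus `ball c (θ * R) \ ball c R` has width at least `2 * s` and misses the ball
`ball a t` with `0 < t ≤ s`, while `ball c R` meets `ball a s`, then `ball a t ⊆ ball c R`. -/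
theorem ball_subset_ball_of_disjoint_annulus {X : Type*} [PseudoMetricSpace X] {a c x : X}
    {θ R s t : ℝ} (ht : 0 < t) (hts : t ≤ s) (hR : 2 * s ≤ (θ - 1) * R)
    (hxc : x ∈ ball c R) (hxa : x ∈ ball a s)
    (hempty : (ball c (θ * R) \ ball c R) ∩ ball a t = ∅) :
    ball a t ⊆ ball c R := by
  have key : ∀ y ∈ ball a t, y ∈ ball c (θ * R) → y ∈ ball c R := fun y hy hyc => by
    by_contra h
    exact (eq_empty_iff_forall_notMem.1 hempty y) ⟨⟨hyc, h⟩, hy⟩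
  simp only [mem_ball] at hxc hxa key
  have hac : dist a c < R := by
    refine key a (by simpa using ht) ?_
    linarith [dist_triangle a x c, dist_comm a x]
  intro y hy
  rw [mem_ball] at hy ⊢
  refine key y hy ?_
  linarith [dist_triangle y a c]

/-- Under hypothesis (D) together with (i) `B(z_p, r_p/θ) ⊄ E_{lvl(p)+1}` for
every `p`, and (ii) `(θ − 1) r_i ≥ 3 θ r_j` whenever `lvl i ≥ lvl j + 2`: if `lvl j = k`,
`lvl i = l ≥ k + 2`, the annulus `A_i` meets `B(z_j, r_j/θ)`, and `l` is the minimal such level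
above `k`, then `A_i ∩ B(z_j, r_j/√θ) ∩ E_{k+1} = ∅`. -/
theorem stmt_6
    (d : ℕ) (hd : 1 ≤ d)
    (θ : ℝ) (hθ : 1 < θ)
    (K : ℕ)
    (J : Type) [Fintype J]
    (lvl : J → ℕ) (hlvl : ∀ j, lvl j ≤ K)
    (z : J → EuclideanSpace ℝ (Fin d)) (r : J → ℝ) (hr : ∀ j, 0 < r j)
    (E : ℕ → Set (EuclideanSpace ℝ (Fin d)))
    (hEtop : E (K + 1) = ∅)
    (hErec : ∀ k ≤ K, E k =
      (E (k + 1) \ ⋃ j, ⋃ (_ : lvl j = k),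
          (ball (z j) (θ * r j) \ ball (z j) (r j)))
        ∪ ⋃ j, ⋃ (_ : lvl j = k), ball (z j) (r j))
    (hD : ∀ i j : J, i ≠ j → |(lvl i : ℤ) - (lvl j : ℤ)| ≤ 1 →
      Disjoint (ball (z i) (θ ^ 2 * r i)) (ball (z j) (θ ^ 2 * r j)))
    (hnotsub : ∀ p : J, ¬ ball (z p) (r p / θ) ⊆ E (lvl p + 1))
    (hsize : ∀ i j : J, lvl j + 2 ≤ lvl i → (θ - 1) * r i ≥ 3 * θ * r j)
    (j i : J)
    (hi : lvl j + 2 ≤ lvl i)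
    (hmeet : ((ball (z i) (θ * r i) \ ball (z i) (r i))
        ∩ ball (z j) (r j / θ)).Nonempty)
    (hmin : ∀ i' : J, lvl j + 1 ≤ lvl i' → lvl i' < lvl i →
      (ball (z i') (θ * r i') \ ball (z i') (r i')) ∩ ball (z j) (r j / θ) = ∅) :
    (ball (z i) (θ * r i) \ ball (z i) (r i))
      ∩ ball (z j) (r j / Real.sqrt θ)
      ∩ E (lvl j + 1) = ∅ := by
  have hmem := fun n hn x => mem_recursive_set_iff (n := n) hlvl hEtop hErec hn x
  have hθ0 : 0 < θ := one_pos.trans hθ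
  have hdil : ∀ p x, x ∈ ball (z p) (r p) → x ∈ ball (z p) (θ ^ 2 * r p) := fun p x hx =>
    ball_subset_ball (le_mul_of_one_le_left (hr p).le (one_le_pow₀ hθ.le)) hx
  have hjK : lvl j + 1 ≤ K + 1 := Nat.succ_le_succ (hlvl j)
  rw [eq_empty_iff_forall_notMem]
  rintro x ⟨⟨⟨hxi, hxi'⟩, hxj⟩, hxE⟩
  obtain ⟨p, hp, hxp, hA⟩ := (hmem _ hjK x).1 hxE
  have hxj' : x ∈ ball (z j) (r j) :=
    ball_subset_ball (div_le_self (hr j).le (Real.one_le_sqrt.2 hθ.le)) hxj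
  have hpi : lvl p < lvl i := by
    by_contra! h
    rcases h.eq_or_lt with h | h
    · have hne : i ≠ p := by
        rintro rfl
        exact hxi' hxp
      refine disjoint_left.1 (hD i p hne (by simp [h])) ?_ (hdil p x hxp)
      refine ball_subset_ball (mul_le_mul_of_nonneg_right ?_ (hr i).le) hxi
      nlinarith
    · exact hA i (by omega) h ⟨hxi, hxi'⟩
  have hpj : lvl j + 2 ≤ lvl p := by
    by_contra! h
    have hne : p ≠ j := by
      rintro rfl
      omega
    exact disjoint_left.1 (hD p j hne (by rw [abs_le]; omega)) (hdil p x hxp) (hdil j x hxj')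
  have hsub : ball (z j) (r j / θ) ⊆ ball (z p) (r p) := by
    refine ball_subset_ball_of_disjoint_annulus (div_pos (hr j) hθ0)
      (div_le_self (hr j).le hθ.le) ?_ hxp hxj' (hmin p hp hpi)
    nlinarith [hsize p j hpj, hr j]
  refine hnotsub j fun y hy => (hmem _ hjK y).2 ⟨p, hp, hsub hy, fun q hq hqp hyq => ?_⟩
  exact (eq_empty_iff_forall_notMem.1 (hmin q hq (hqp.trans hpi)) y) ⟨hyq, hy⟩
end

section
/- For every dimension d ≥ 1 there exists a constant c = c(d) > 0 such that the following holds. Let z, x ∈ ℝ^d, let θ > 1, R > 0, and let 0 < a < b be real numbers with (θ − 1) R ≥ 3 (b − a). Consider the open annulus A := B(z, θR) ∖ closedBall(z, R). If the open ball B(x, a) intersects A, then the Lebesgue measure satisfies |B(x, b) ∩ A| ≥ c (b − a)^d. -/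
open Metric Set MeasureTheory

/-- A point `p` other than `z` can be moved by `|s|` along the ray from `z` so that its distance
to `z` changes by exactly `s`, as long as this distance stays nonnegative. -/
lemma exists_dist_eq_abs_and_dist_eq_add {E : Type*} [NormedAddCommGroup E] [NormedSpace ℝ E]
    {z p : E} (hp : 0 < dist p z) {s : ℝ} (hs : 0 ≤ dist p z + s) :
    ∃ q : E, dist q p = |s| ∧ dist q z = dist p z + s := by
  rw [dist_eq_norm] at hp hs
  refine ⟨p + (s / ‖p - z‖) • (p - z), ?_, ?_⟩
  · rw [dist_eq_norm, add_sub_cancel_left, norm_smul, Real.norm_eq_abs, abs_div, abs_norm,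
      div_mul_cancel₀ _ hp.ne']
  · have h : p + (s / ‖p - z‖) • (p - z) - z = ((‖p - z‖ + s) / ‖p - z‖) • (p - z) := by
      rw [add_div, div_self hp.ne', add_smul, one_smul]
      abel
    rw [dist_eq_norm, dist_eq_norm, h, norm_smul, Real.norm_eq_abs, abs_div, abs_norm,
      abs_of_nonneg hs, div_mul_cancel₀ _ hp.ne']

/-- If a ball of radius `a` meets an annulus of width at least `2 * (b - a)`, then the concentric
ball of radius `b` contains a ball of radius `(b - a) / 2` lying in the annulus. -/
lemma exists_ball_subset_ball_inter_annulus {E : Type*} [NormedAddCommGroup E] [NormedSpace ℝ E]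
    {z x : E} {r R a b : ℝ} (hr : 0 ≤ r) (hab : a ≤ b) (hw : 2 * (b - a) ≤ R - r)
    (hne : (ball x a ∩ (ball z R \ closedBall z r)).Nonempty) :
    ∃ q : E, ball q ((b - a) / 2) ⊆ ball x b ∩ (ball z R \ closedBall z r) := by
  obtain ⟨p, hpx, hpR, hpr⟩ := hne
  rw [mem_ball] at hpx hpR
  rw [mem_closedBall, not_le] at hpr
  obtain ⟨q, hqp, hq₁, hq₂⟩ : ∃ q : E, dist q p = (b - a) / 2 ∧
      r + (b - a) / 2 ≤ dist q z ∧ dist q z ≤ R - (b - a) / 2 := by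
    have habs : |(b - a) / 2| = (b - a) / 2 := abs_of_nonneg (by linarith)
    rcases le_total (dist p z + (b - a)) R with h | h
    · obtain ⟨q, h₁, h₂⟩ := exists_dist_eq_abs_and_dist_eq_add (z := z) (p := p)
        (s := (b - a) / 2) (by linarith) (by linarith)
      exact ⟨q, h₁.trans habs, by linarith, by linarith⟩
    · obtain ⟨q, h₁, h₂⟩ := exists_dist_eq_abs_and_dist_eq_add (z := z) (p := p)
        (s := -((b - a) / 2)) (by linarith) (by linarith)
      exact ⟨q, by rw [h₁, abs_neg, habs], by linarith, by linarith⟩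
  refine ⟨q, fun y hy => ?_⟩
  rw [mem_ball] at hy
  have h₁ := dist_triangle4 y q p x
  have h₂ := dist_triangle y q z
  have h₃ := dist_triangle_left q z y
  refine ⟨?_, ?_, ?_⟩
  · rw [mem_ball]; linarith
  · rw [mem_ball]; linarith
  · rw [mem_closedBall, not_le]; linarith

/-- For every dimension `d ≥ 1` there is `c = c(d) > 0` such that: for a thick
annulus `A = B(z, θR) ∖ closedBall(z, R)` with `(θ − 1) R ≥ 3 (b − a)`, if the ball `B(x, a)`
meets `A`, then `|B(x, b) ∩ A| ≥ c (b − a)^d`. -/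
theorem stmt_7
    (d : ℕ) (hd : 1 ≤ d) :
    ∃ c : ℝ, 0 < c ∧
      ∀ (z x : EuclideanSpace ℝ (Fin d)) (θ R a b : ℝ),
        1 < θ → 0 < R → 0 < a → a < b → (θ - 1) * R ≥ 3 * (b - a) →
        (ball x a ∩ (ball z (θ * R) \ closedBall z R)).Nonempty →
        ENNReal.ofReal (c * (b - a) ^ d) ≤
          volume (ball x b ∩ (ball z (θ * R) \ closedBall z R)) := by
  set v := volume (ball (0 : EuclideanSpace ℝ (Fin d)) 1) with hv
  have hv_top : v ≠ ⊤ := measure_ball_lt_top.ne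
  have hv_pos : 0 < v.toReal :=
    ENNReal.toReal_pos (measure_ball_pos volume _ one_pos).ne' hv_top
  refine ⟨(1 / 2) ^ d * v.toReal, by positivity, ?_⟩
  intro z x θ R a b _ hR _ hab hw hne
  obtain ⟨q, hq⟩ := exists_ball_subset_ball_inter_annulus hR.le hab.le (by linarith) hne
  refine le_of_eq_of_le ?_ (measure_mono hq)
  rw [Measure.addHaar_ball_of_pos volume q (by linarith : 0 < (b - a) / 2), finrank_euclideanSpace_fin,
    ← hv, ← ENNReal.ofReal_toReal hv_top, ← ENNReal.ofReal_mul (by have := sub_pos.2 hab; positivity),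
    ENNReal.toReal_ofReal hv_pos.le]
  congr 1
  rw [div_pow, div_pow]
  ring
end

section
/- Assume hypothesis (D). Let g : ℝ^d → ℝ be Lebesgue integrable and assume the compatibility conditions: for every j ∈ J, writing k := lvl(j), ∫_{A_j ∩ E_{k+1}} g dx = ∫_{B_j ∖ E_{k+1}} g dx. Then ∫_{E_k} g dx = 0 for every k ∈ {0, …, K+1}; in particular ∫_{E} g dx = 0. -/
open Metric Set MeasureTheory

/-- Removing sets `A i` from `F` and adding sets `B i` does not change the integral of `g` when
each removed piece `A i ∩ F` carries the same integral as the added piece `B i \ F`. -/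
theorem setIntegral_diff_iUnion_union_iUnion {X ι : Type*} [MeasurableSpace X] {μ : Measure X}
    [Finite ι] {A B : ι → Set X} {F : Set X} {g : X → ℝ} (hg : Integrable g μ)
    (hA : ∀ i, MeasurableSet (A i)) (hB : ∀ i, MeasurableSet (B i)) (hF : MeasurableSet F)
    (hAA : Pairwise (Function.onFun Disjoint A)) (hBB : Pairwise (Function.onFun Disjoint B))
    (hAB : ∀ i j, Disjoint (A i) (B j))
    (h : ∀ i, ∫ x in A i ∩ F, g x ∂μ = ∫ x in B i \ F, g x ∂μ) :
    ∫ x in (F \ ⋃ i, A i) ∪ ⋃ i, B i, g x ∂μ = ∫ x in F, g x ∂μ := by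
  cases nonempty_fintype ι
  have hnew : (F \ ⋃ i, A i) ∪ ⋃ i, B i = (F \ ⋃ i, A i) ∪ ⋃ i, B i \ F := by
    ext x
    simp only [mem_union, mem_sdiff, mem_iUnion, not_exists]
    constructor
    · rintro (hx | ⟨i, hi⟩)
      · exact Or.inl hx
      · by_cases hxF : x ∈ F
        · exact Or.inl ⟨hxF, fun j hj => disjoint_left.1 (hAB j i) hj hi⟩
        · exact Or.inr ⟨i, hi, hxF⟩
    · rintro (hx | ⟨i, hi, -⟩)
      · exact Or.inl hx
      · exact Or.inr ⟨i, hi⟩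
  have hold : (F \ ⋃ i, A i) ∪ ⋃ i, A i ∩ F = F := by
    rw [← iUnion_inter, inter_comm, sdiff_union_inter]
  have hAm : MeasurableSet (⋃ i, A i ∩ F) := .iUnion fun i => (hA i).inter hF
  have hBm : MeasurableSet (⋃ i, B i \ F) := .iUnion fun i => (hB i).diff hF
  calc ∫ x in (F \ ⋃ i, A i) ∪ ⋃ i, B i, g x ∂μ
      = ∫ x in F \ ⋃ i, A i, g x ∂μ + ∑ i, ∫ x in B i \ F, g x ∂μ := by
        rw [hnew, setIntegral_union _ hBm hg.integrableOn hg.integrableOn,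
          integral_iUnion_fintype (fun i => (hB i).diff hF)
            (fun i j hij => (hBB hij).mono sdiff_subset sdiff_subset) fun i => hg.integrableOn]
        rw [disjoint_iUnion_right]
        exact fun i => disjoint_sdiff_right.mono_left sdiff_subset
    _ = ∫ x in F \ ⋃ i, A i, g x ∂μ + ∑ i, ∫ x in A i ∩ F, g x ∂μ := by simp only [h]
    _ = ∫ x in (F \ ⋃ i, A i) ∪ ⋃ i, A i ∩ F, g x ∂μ := by
        rw [setIntegral_union _ hAm hg.integrableOn hg.integrableOn,
          integral_iUnion_fintype (fun i => (hA i).inter hF)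
            (fun i j hij => (hAA hij).mono inter_subset_left inter_subset_left)
            fun i => hg.integrableOn]
        rw [← iUnion_inter]
        exact disjoint_sdiff_left.mono_right inter_subset_left
    _ = ∫ x in F, g x ∂μ := by rw [hold]

/-- Under hypothesis (D), if `g` is Lebesgue integrable and satisfies the
compatibility conditions `∫_{A_j ∩ E_{k+1}} g = ∫_{B_j ∖ E_{k+1}} g` (with `k = lvl j`) for
every `j ∈ J`, then `∫_{E_k} g = 0` for every `k ∈ {0, …, K+1}`; in particular `∫_E g = 0`. -/
theorem stmt_9
    (d : ℕ) (hd : 1 ≤ d)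
    (θ : ℝ) (hθ : 1 < θ)
    (K : ℕ)
    (J : Type) [Fintype J]
    (lvl : J → ℕ) (hlvl : ∀ j, lvl j ≤ K)
    (z : J → EuclideanSpace ℝ (Fin d)) (r : J → ℝ) (hr : ∀ j, 0 < r j)
    (E : ℕ → Set (EuclideanSpace ℝ (Fin d)))
    (hEtop : E (K + 1) = ∅)
    (hErec : ∀ k ≤ K, E k =
      (E (k + 1) \ ⋃ j, ⋃ (_ : lvl j = k),
          (ball (z j) (θ * r j) \ ball (z j) (r j)))
        ∪ ⋃ j, ⋃ (_ : lvl j = k), ball (z j) (r j))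
    (hD : ∀ i j : J, i ≠ j → |(lvl i : ℤ) - (lvl j : ℤ)| ≤ 1 →
      Disjoint (ball (z i) (θ ^ 2 * r i)) (ball (z j) (θ ^ 2 * r j)))
    (g : EuclideanSpace ℝ (Fin d) → ℝ) (hg : Integrable g)
    (hcomp : ∀ j : J,
      ∫ x in (ball (z j) (θ * r j) \ ball (z j) (r j)) ∩ E (lvl j + 1), g x
        = ∫ x in ball (z j) (r j) \ E (lvl j + 1), g x) :
    (∀ k ≤ K + 1, ∫ x in E k, g x = 0) ∧ ∫ x in E 0, g x = 0 := by
  have hrθ (j : J) : ball (z j) (r j) ⊆ ball (z j) (θ ^ 2 * r j) :=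
    ball_subset_ball (by nlinarith [hr j, mul_pos (hr j) (sub_pos.2 hθ)])
  have hθθ (j : J) : ball (z j) (θ * r j) \ ball (z j) (r j) ⊆ ball (z j) (θ ^ 2 * r j) :=
    sdiff_subset.trans <| ball_subset_ball <|
      mul_le_mul_of_nonneg_right (by nlinarith) (hr j).le
  have key : ∀ k ≤ K + 1, MeasurableSet (E k) ∧ ∫ x in E k, g x = 0 := by
    intro k hk
    induction hk using Nat.decreasingInduction with
    | self => simp [hEtop]
    | of_succ k hk ih =>
      obtain ⟨hm, hint⟩ := ih
      have hdisj (i j : {j // lvl j = k}) (hij : i ≠ j) :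
          Disjoint (ball (z i) (θ ^ 2 * r i)) (ball (z j) (θ ^ 2 * r j)) :=
        hD i j (Subtype.coe_ne_coe.2 hij) (by simp [i.2, j.2])
      have hE := hErec k (Nat.lt_succ_iff.1 hk)
      rw [← iUnion_subtype (fun j => lvl j = k)
          fun j => ball (z j) (θ * r j) \ ball (z j) (r j),
        ← iUnion_subtype (fun j => lvl j = k) fun j => ball (z j) (r j)] at hE
      have hA (j : {j // lvl j = k}) :
          MeasurableSet (ball (z j) (θ * r j) \ ball (z j) (r j)) :=
        measurableSet_ball.diff measurableSet_ball
      rw [hE]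
      refine ⟨(hm.diff (.iUnion hA)).union (.iUnion fun _ => measurableSet_ball), ?_⟩
      rw [setIntegral_diff_iUnion_union_iUnion hg hA (fun _ => measurableSet_ball) hm
        (fun i j hij => (hdisj i j hij).mono (hθθ i) (hθθ j))
        (fun i j hij => (hdisj i j hij).mono (hrθ i) (hrθ j)) ?_ ?_, hint]
      · intro i j
        rcases eq_or_ne i j with rfl | hij
        · exact disjoint_sdiff_left
        · exact (hdisj i j hij).mono (hθθ i) (hrθ j)
      · rintro ⟨j, rfl⟩
        exact hcomp j
  exact ⟨fun k hk => (key k hk).2, (key 0 (Nat.zero_le _)).2⟩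
end

section
/- Let (X, μ) be a measure space, J a finite index set, and q ≥ 1 a real number. For each j ∈ J let U_j ⊆ X be measurable with μ(U_j) < ∞, let F_j ⊆ X be measurable, and let g_j ∈ ℝ. Let g : X → ℝ be measurable with ∫_X |g|^q dμ < ∞, and let C₁ ≥ 0, c₀ > 0 be constants and N a natural number. Assume: (i) for every j ∈ J, μ(F_j) · |g_j| ≤ C₁ ∫_{U_j} |g| dμ; (ii) for every j ∈ J, μ(F_j) ≥ c₀ μ(U_j); (iii) every x ∈ X belongs to U_j for at most N indices j. Then Σ_{j ∈ J} μ(F_j) |g_j|^q ≤ N C₁^q c₀^{1−q} ∫_X |g|^q dμ. -/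
open Set MeasureTheory
open scoped ENNReal

/-- Jensen's inequality for the power `q ≥ 1`, in the form that does not normalize the measure. -/
theorem lintegral_enorm_rpow_le_measure_univ_rpow_mul {X : Type*} [MeasurableSpace X]
    {μ : Measure X} {q : ℝ} (hq : 1 ≤ q) {g : X → ℝ} (hg : AEStronglyMeasurable g μ) :
    (∫⁻ x, ‖g x‖ₑ ∂μ) ^ q ≤ μ univ ^ (q - 1) * ∫⁻ x, ‖g x‖ₑ ^ q ∂μ := by
  have hq0 : 0 < q := zero_lt_one.trans_le hq
  have h := eLpNorm'_le_eLpNorm'_mul_rpow_measure_univ zero_lt_one hq hg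
  simp only [eLpNorm', ENNReal.rpow_one, div_one] at h
  calc (∫⁻ x, ‖g x‖ₑ ∂μ) ^ q
      ≤ ((∫⁻ x, ‖g x‖ₑ ^ q ∂μ) ^ (1 / q) * μ univ ^ (1 - 1 / q)) ^ q := by gcongr
    _ = μ univ ^ (q - 1) * ∫⁻ x, ‖g x‖ₑ ^ q ∂μ := by
        rw [ENNReal.mul_rpow_of_nonneg _ _ hq0.le, ← ENNReal.rpow_mul, ← ENNReal.rpow_mul,
          one_div_mul_cancel hq0.ne', ENNReal.rpow_one, mul_comm, sub_mul,
          one_div_mul_cancel hq0.ne', one_mul]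

/-- The integrals of a function over finitely many sets of overlap at most `N` add up to at most
`N` times its integral. -/
theorem sum_setLIntegral_le_of_card_le {X J : Type*} [MeasurableSpace X] {μ : Measure X}
    [Fintype J] {U : J → Set X} (hU : ∀ j, MeasurableSet (U j)) {N : ℕ}
    (hN : ∀ x, Nat.card {j : J // x ∈ U j} ≤ N) {f : X → ℝ≥0∞} (hf : Measurable f) :
    ∑ j, ∫⁻ x in U j, f x ∂μ ≤ N * ∫⁻ x, f x ∂μ := by
  classical
  simp_rw [← lintegral_indicator (hU _)]
  rw [← lintegral_finsetSum _ fun j _ => hf.indicator (hU j), ← lintegral_const_mul _ hf]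
  refine lintegral_mono fun x => ?_
  simp only [indicator_apply]
  rw [← Finset.sum_filter, Finset.sum_const, nsmul_eq_mul]
  gcongr
  simpa [Nat.card_eq_fintype_card, Fintype.card_subtype] using hN x

/-- Cancelling a power of `a` from a bound on `a * b`. -/
theorem ENNReal.mul_rpow_le_of_mul_le {a b c C I K u : ℝ≥0∞} {q : ℝ} (hq : 1 ≤ q)
    (hc : c ≠ 0) (hc' : c ≠ ⊤) (hC : C ≠ ⊤) (hu : u ≠ ⊤) (hK : K ≠ ⊤)
    (hab : a * b ≤ C * I) (hua : c * u ≤ a) (hI : I ^ q ≤ u ^ (q - 1) * K) :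
    a * b ^ q ≤ C ^ q * c ^ (1 - q) * K := by
  have hq0 : 0 < q := zero_lt_one.trans_le hq
  have hq1 : 0 ≤ q - 1 := sub_nonneg.2 hq
  rcases eq_or_ne a 0 with rfl | ha
  · simp
  rcases eq_or_ne a ⊤ with rfl | ha'
  · have hI' : I ≠ ⊤ := fun h => by
      rw [h, ENNReal.top_rpow_of_pos hq0] at hI
      exact (ENNReal.mul_lt_top (ENNReal.rpow_lt_top_of_nonneg hq1 hu) hK.lt_top).not_ge hI
    have hb : b = 0 := by
      by_contra hb
      rw [ENNReal.top_mul hb] at hab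
      exact (ENNReal.mul_lt_top hC.lt_top hI'.lt_top).not_ge hab
    simp [hb, ENNReal.zero_rpow_of_pos hq0]
  have hpow0 : a ^ (q - 1) ≠ 0 := by simp [ENNReal.rpow_eq_zero_iff, ha, ha']
  have hpow : a ^ (q - 1) ≠ ⊤ := ENNReal.rpow_ne_top_of_nonneg hq1 ha'
  have hu' : u ≤ c⁻¹ * a := by
    rwa [mul_comm, ← div_eq_mul_inv, ENNReal.le_div_iff_mul_le (.inl hc) (.inl hc'), mul_comm]
  refine (ENNReal.mul_le_mul_iff_right hpow0 hpow).1 ?_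
  calc a ^ (q - 1) * (a * b ^ q) = (a * b) ^ q := by
        rw [ENNReal.mul_rpow_of_nonneg _ _ hq0.le, ← mul_assoc]
        congr 1
        nth_rewrite 2 [← ENNReal.rpow_one a]
        rw [← ENNReal.rpow_add _ _ ha ha', sub_add_cancel]
    _ ≤ (C * I) ^ q := by gcongr
    _ = C ^ q * I ^ q := ENNReal.mul_rpow_of_nonneg _ _ hq0.le
    _ ≤ C ^ q * ((c⁻¹ * a) ^ (q - 1) * K) := by
        gcongr
        exact hI.trans (by gcongr)
    _ = a ^ (q - 1) * (C ^ q * c ^ (1 - q) * K) := by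
        rw [ENNReal.mul_rpow_of_nonneg _ _ hq1, ENNReal.inv_rpow, ← ENNReal.rpow_neg, neg_sub]
        ring

/-- Hölder plus bounded overlap: sets `U_j` of finite measure with overlap at
most `N`, companion sets `F_j` with `μ(F_j) ≥ c₀ μ(U_j)`, and constants `g_j` with
`μ(F_j)|g_j| ≤ C₁ ∫_{U_j} |g| dμ` give
`Σ_j μ(F_j)|g_j|^q ≤ N C₁^q c₀^{1−q} ∫_X |g|^q dμ`. -/
theorem stmt_10
    (X : Type) [MeasurableSpace X] (μ : Measure X)
    (J : Type) [Fintype J]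
    (q : ℝ) (hq : 1 ≤ q)
    (U F : J → Set X)
    (hU : ∀ j, MeasurableSet (U j)) (hF : ∀ j, MeasurableSet (F j))
    (hUfin : ∀ j, μ (U j) < ⊤)
    (gc : J → ℝ)
    (g : X → ℝ) (hgmeas : Measurable g)
    (hgq : ∫⁻ x, ENNReal.ofReal (|g x| ^ q) ∂μ < ⊤)
    (C₁ : ℝ) (hC₁ : 0 ≤ C₁) (c₀ : ℝ) (hc₀ : 0 < c₀) (N : ℕ)
    (h1 : ∀ j, μ (F j) * ENNReal.ofReal |gc j| ≤
      ENNReal.ofReal C₁ * ∫⁻ x in U j, ENNReal.ofReal |g x| ∂μ)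
    (h2 : ∀ j, ENNReal.ofReal c₀ * μ (U j) ≤ μ (F j))
    (h3 : ∀ x : X, Nat.card {j : J // x ∈ U j} ≤ N) :
    ∑ j : J, μ (F j) * ENNReal.ofReal (|gc j| ^ q) ≤
      (N : ℝ≥0∞) * ENNReal.ofReal (C₁ ^ q * c₀ ^ (1 - q)) *
        ∫⁻ x, ENNReal.ofReal (|g x| ^ q) ∂μ := by
  have hq0 : 0 ≤ q := zero_le_one.trans hq
  simp_rw [← ENNReal.ofReal_rpow_of_nonneg (abs_nonneg _) hq0] at hgq ⊢
  rw [ENNReal.ofReal_mul (by positivity), ← ENNReal.ofReal_rpow_of_nonneg hC₁ hq0,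
    ← ENNReal.ofReal_rpow_of_pos hc₀]
  simp_rw [← Real.enorm_eq_ofReal_abs (g _)] at hgq h1 ⊢
  calc ∑ j, μ (F j) * ENNReal.ofReal |gc j| ^ q
      ≤ ∑ j, ENNReal.ofReal C₁ ^ q * ENNReal.ofReal c₀ ^ (1 - q) *
          ∫⁻ x in U j, ‖g x‖ₑ ^ q ∂μ := by
        refine Finset.sum_le_sum fun j _ => ?_
        refine ENNReal.mul_rpow_le_of_mul_le hq (ENNReal.ofReal_pos.2 hc₀).ne'
          ENNReal.ofReal_ne_top ENNReal.ofReal_ne_top (hUfin j).ne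
          ((setLIntegral_le_lintegral _ _).trans_lt hgq).ne (h1 j) (h2 j) ?_
        simpa using lintegral_enorm_rpow_le_measure_univ_rpow_mul (μ := μ.restrict (U j)) hq
          hgmeas.aestronglyMeasurable
    _ = ENNReal.ofReal C₁ ^ q * ENNReal.ofReal c₀ ^ (1 - q) *
          ∑ j, ∫⁻ x in U j, ‖g x‖ₑ ^ q ∂μ := by rw [Finset.mul_sum]
    _ ≤ ENNReal.ofReal C₁ ^ q * ENNReal.ofReal c₀ ^ (1 - q) *
          (N * ∫⁻ x, ‖g x‖ₑ ^ q ∂μ) := by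
        gcongr
        exact sum_setLIntegral_le_of_card_le hU h3 (hgmeas.enorm.pow_const q)
    _ = _ := by ring
end

section
/- Let K ≥ 0 be an integer, J a finite index set with a level function lvl : J → {0, …, K}, and N a natural number. For each j ∈ J let V_j ⊆ W_j ⊆ ℝ^d be Lebesgue measurable sets, let E ⊆ ℝ^d be measurable, let g : ℝ^d → ℝ be Lebesgue integrable, let a_j ≥ 0 be real numbers, and let P_j ⊆ {i ∈ J : lvl(i) ≤ lvl(j) − 2} be index sets such that W_i ⊆ W_j for every i ∈ P_j. Assume: (i) for every j ∈ J, a_j ≤ ∫_{V_j ∖ E} |g| dx + Σ_{i ∈ P_j} a_i; (ii) every point x ∈ ℝ^d belongs to W_i for at most N indices i ∈ J. Then for every j ∈ J, a_j ≤ (N + 2)^{lvl(j) + 1} ∫_{W_j ∖ E} |g| dx. -/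
open Set MeasureTheory

/-- If every point lies in at most `N` of the sets `A i ⊆ T`, the integrals of a nonnegative
function over the `A i` sum to at most `N` times its integral over `T`. -/
theorem sum_setIntegral_le_of_card_le {α ι : Type*} [MeasurableSpace α] {μ : Measure α}
    {f : α → ℝ} {T : Set α} (hf : IntegrableOn f T μ) (hf0 : ∀ x, 0 ≤ f x)
    {s : Finset ι} {A : ι → Set α} (hA : ∀ i ∈ s, MeasurableSet (A i))
    (hAT : ∀ i ∈ s, A i ⊆ T) {N : ℕ}
    (hN : ∀ x, ∀ t ⊆ s, (∀ i ∈ t, x ∈ A i) → t.card ≤ N) :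
    ∑ i ∈ s, ∫ x in A i, f x ∂μ ≤ N * ∫ x in T, f x ∂μ := by
  classical
  calc ∑ i ∈ s, ∫ x in A i, f x ∂μ
      = ∑ i ∈ s, ∫ x in T, (A i).indicator f x ∂μ := by
        refine Finset.sum_congr rfl fun i hi => ?_
        rw [setIntegral_indicator (hA i hi), inter_eq_self_of_subset_right (hAT i hi)]
    _ = ∫ x in T, ∑ i ∈ s, (A i).indicator f x ∂μ :=
        (integral_finsetSum s fun i hi => hf.indicator (hA i hi)).symm
    _ ≤ ∫ x in T, N * f x ∂μ := by
        refine integral_mono (integrable_finsetSum s fun i hi => hf.indicator (hA i hi))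
          (hf.const_mul _) fun x => ?_
        simp only [indicator_apply, ← Finset.sum_filter, Finset.sum_const, nsmul_eq_mul]
        refine mul_le_mul_of_nonneg_right ?_ (hf0 x)
        exact_mod_cast hN x _ (Finset.filter_subset _ s) fun i hi => (Finset.mem_filter.1 hi).2
    _ = N * ∫ x in T, f x ∂μ := integral_const_mul _ _

/-- The recursive estimate for the constants of the piecewise-constant
extension: nonnegative quantities `a_j` on a leveled finite index set, each controlled by the
`L¹` mass of `g` on `V_j ∖ E` plus the `a_i` for indices at least two levels below with
`W_i ⊆ W_j`, under a global overlap bound `N` for the sets `W_i`, satisfy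
`a_j ≤ (N + 2)^{lvl(j)+1} ∫_{W_j ∖ E} |g|`. -/
theorem stmt_11
    (d K N : ℕ)
    (J : Type) [Fintype J]
    (lvl : J → ℕ) (hlvl : ∀ j, lvl j ≤ K)
    (V W : J → Set (EuclideanSpace ℝ (Fin d)))
    (hVW : ∀ j, V j ⊆ W j)
    (hV : ∀ j, MeasurableSet (V j)) (hW : ∀ j, MeasurableSet (W j))
    (E : Set (EuclideanSpace ℝ (Fin d))) (hE : MeasurableSet E)
    (g : EuclideanSpace ℝ (Fin d) → ℝ) (hg : Integrable g)
    (a : J → ℝ) (ha : ∀ j, 0 ≤ a j)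
    (P : J → Finset J)
    (hP : ∀ j, ∀ i ∈ P j, lvl i + 2 ≤ lvl j)
    (hPW : ∀ j, ∀ i ∈ P j, W i ⊆ W j)
    (h1 : ∀ j, a j ≤ (∫ x in V j \ E, |g x|) + ∑ i ∈ P j, a i)
    (h2 : ∀ x, Nat.card {i : J // x ∈ W i} ≤ N) :
    ∀ j, a j ≤ (N + 2 : ℝ) ^ (lvl j + 1) * ∫ x in W j \ E, |g x| := by
  classical
  have hint : ∀ S, IntegrableOn (fun x => |g x|) S := fun S => hg.abs.integrableOn
  have hoverlap : ∀ j, ∑ i ∈ P j, ∫ x in W i \ E, |g x| ≤ N * ∫ x in W j \ E, |g x| := by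
    refine fun j => sum_setIntegral_le_of_card_le (hint _) (fun x => abs_nonneg _)
      (fun i _ => (hW i).diff hE) (fun i hi => sdiff_subset_sdiff_left (hPW j i hi))
      fun x t _ ht => ?_
    refine le_trans ?_ (h2 x)
    rw [Nat.card_eq_fintype_card, Fintype.card_subtype]
    exact Finset.card_le_card fun i hi => by simpa using (ht i hi).1
  intro j
  induction hn : lvl j using Nat.strong_induction_on generalizing j with
  | _ n ih =>
    subst hn
    have hI : 0 ≤ ∫ x in W j \ E, |g x| := integral_nonneg fun x => abs_nonneg _
    have hV_le : ∫ x in V j \ E, |g x| ≤ ∫ x in W j \ E, |g x| :=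
      setIntegral_mono_set (hint _) (ae_of_all _ fun x => abs_nonneg _)
        (sdiff_subset_sdiff_left (hVW j)).eventuallyLE
    have hone : (1 : ℝ) ≤ N + 2 := by linarith [Nat.cast_nonneg (α := ℝ) N]
    have hpow : (1 : ℝ) ≤ (N + 2 : ℝ) ^ lvl j := one_le_pow₀ hone
    have hsum : ∑ i ∈ P j, a i ≤ (N + 2 : ℝ) ^ lvl j * (N * ∫ x in W j \ E, |g x|) := by
      calc ∑ i ∈ P j, a i ≤ ∑ i ∈ P j, (N + 2 : ℝ) ^ lvl j * ∫ x in W i \ E, |g x| := by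
            refine Finset.sum_le_sum fun i hi => ?_
            have hlt := hP j i hi
            exact (ih _ (by omega) i rfl).trans (mul_le_mul_of_nonneg_right
              (pow_le_pow_right₀ hone (by omega)) (integral_nonneg fun x => abs_nonneg _))
        _ = (N + 2 : ℝ) ^ lvl j * ∑ i ∈ P j, ∫ x in W i \ E, |g x| :=
            (Finset.mul_sum ..).symm
        _ ≤ _ := mul_le_mul_of_nonneg_left (hoverlap j) (by positivity)
    rw [pow_succ]
    nlinarith [h1 j, mul_le_mul_of_nonneg_right hpow hI]
end
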